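/- arXiv:1503.04002 — 3 statements merged into one kernel-verified Lean document; each statement's English description precedes it below -/
import Mathlib

section
/- Let G be a subgroup of the symmetric group S_n, viewed as a set of n×n permutation matrices in ℝ^{n×n}, and let P(G) be its convex hull (the permutation polytope of G). If H is a subgroup of G such that P(H) is a face of P(G), then there exists a partition [n] = ⊔_k I_k of the ground set such that H = stab(G;(I_k)_k) = {σ ∈ G : σ(I_k) = I_k for all k}. Equivalently, H equals the stabilizer in G of the partition of [n] into the orbits of H. -/
/-- The permutation matrix of `σ ∈ S_n`, with `(i,j)` entry `1` iff `σ j = i`. -/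
noncomputable def permMat (n : ℕ) (σ : Equiv.Perm (Fin n)) : Matrix (Fin n) (Fin n) ℝ :=
  fun i j => if σ j = i then 1 else 0

/-- The permutation polytope of a set of permutations: the convex hull in `ℝ^{n×n}`
of the corresponding permutation matrices. -/
noncomputable def permPoly (n : ℕ) (S : Set (Equiv.Perm (Fin n))) :
    Set (Matrix (Fin n) (Fin n) ℝ) :=
  convexHull ℝ (permMat n '' S)

theorem mem_of_permMat_mem_permPoly {n : ℕ} {S : Set (Equiv.Perm (Fin n))}
    {τ : Equiv.Perm (Fin n)} (h : permMat n τ ∈ permPoly n S) : τ ∈ S := by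
  by_contra hτ
  let f : Matrix (Fin n) (Fin n) ℝ → ℝ := fun M => ∑ j, M (τ j) j
  have hf : IsLinearMap ℝ f :=
    ⟨fun M N => by simp [f, Finset.sum_add_distrib], fun c M => by simp [f, Finset.mul_sum]⟩
  have hlt : permPoly n S ⊆ {M | f M < n} := by
    refine convexHull_min ?_ (convex_halfSpace_lt hf _)
    rintro _ ⟨ρ, hρ, rfl⟩
    obtain ⟨j, hj⟩ : ∃ j, ρ j ≠ τ j := by
      by_contra! hall
      exact hτ (Equiv.ext hall ▸ hρ)
    have : f (permMat n ρ) < ∑ _j : Fin n, (1 : ℝ) := by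
      refine Finset.sum_lt_sum (fun k _ => ?_) ⟨j, Finset.mem_univ j, ?_⟩
      · unfold permMat; split_ifs <;> norm_num
      · simp [permMat, hj]
    simpa using this
  have := hlt h
  simp [f, permMat] at this

/-- If `σ` moves every point within its `H`-orbit, then the cosets `σH` and `H` have the same
barycenter. -/
theorem sum_permMat_mul_eq {n : ℕ} (H : Subgroup (Equiv.Perm (Fin n))) [Fintype H]
    {σ : Equiv.Perm (Fin n)} (hσ : ∀ i, ∃ g ∈ H, g i = σ i) :
    ∑ h : H, permMat n (σ * h) = ∑ h : H, permMat n h := by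
  ext i j
  obtain ⟨g, hg, hgi⟩ := hσ (σ.symm i)
  rw [Equiv.apply_symm_apply] at hgi
  rw [Matrix.sum_apply, Matrix.sum_apply,
    ← Equiv.sum_comp (Equiv.mulLeft (⟨g, hg⟩ : H)) (fun h : H => permMat n h i j)]
  refine Finset.sum_congr rfl fun h _ => ?_
  have : σ ((h : Equiv.Perm (Fin n)) j) = i ↔ g ((h : Equiv.Perm (Fin n)) j) = i := by
    rw [← Equiv.eq_symm_apply, ← hgi, g.injective.eq_iff, hgi]
  exact if_congr this rfl rfl

theorem mem_of_isExtreme_permPoly {n : ℕ} {G H : Subgroup (Equiv.Perm (Fin n))}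
    (hface : IsExtreme ℝ (permPoly n (G : Set (Equiv.Perm (Fin n))))
      (permPoly n (H : Set (Equiv.Perm (Fin n)))))
    (hHG : H ≤ G) {σ : Equiv.Perm (Fin n)} (hσG : σ ∈ G) (hσ : ∀ i, ∃ g ∈ H, g i = σ i) :
    σ ∈ H := by
  classical
  by_contra hσH
  have hsum : ∑ _h : H, (Fintype.card H : ℝ)⁻¹ = 1 := by
    simp
  have hdiff := (hface.convex_sdiff (convex_convexHull ℝ _)).sum_mem (t := Finset.univ)
    (w := fun _ : H => (Fintype.card H : ℝ)⁻¹) (z := fun h : H => permMat n (σ * h))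
    (fun _ _ => by positivity) hsum fun h _ =>
      ⟨subset_convexHull ℝ _ ⟨_, G.mul_mem hσG (hHG h.2), rfl⟩, fun hmem =>
        hσH ((H.mul_mem_cancel_right h.2).1 (mem_of_permMat_mem_permPoly hmem))⟩
  refine hdiff.2 ?_
  rw [← Finset.smul_sum, sum_permMat_mul_eq H hσ, Finset.smul_sum]
  exact (convex_convexHull ℝ _).sum_mem (fun _ _ => by positivity) hsum
    fun h _ => subset_convexHull ℝ _ ⟨_, h.2, rfl⟩

/-- If `H ≤ G ≤ S_n` and `P(H)` is a face (extreme subset) of `P(G)`, then there is a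
partition of `[n]` whose stabilizer in `G` is exactly `H`. -/
theorem perm_polytope_face_subgroup_is_partition_stabilizer
    (n : ℕ) (G H : Subgroup (Equiv.Perm (Fin n))) (hHG : H ≤ G)
    (hface : IsExtreme ℝ (permPoly n (G : Set (Equiv.Perm (Fin n))))
      (permPoly n (H : Set (Equiv.Perm (Fin n))))) :
    ∃ Part : Set (Set (Fin n)), Setoid.IsPartition Part ∧
      ∀ σ : Equiv.Perm (Fin n), σ ∈ H ↔ (σ ∈ G ∧ ∀ I ∈ Part, ⇑σ '' I = I) := by
  refine ⟨(MulAction.orbitRel H (Fin n)).classes, Setoid.isPartition_classes _, fun σ =>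
    ⟨fun hσ => ⟨hHG hσ, ?_⟩, fun ⟨hσG, hσ⟩ => mem_of_isExtreme_permPoly hface hHG hσG ?_⟩⟩
  · rintro _ ⟨i, rfl⟩
    exact MulAction.smul_orbit (⟨σ, hσ⟩ : H) i
  · intro i
    have hmem : σ i ∈ MulAction.orbit H i :=
      (hσ (MulAction.orbit H i) ⟨i, rfl⟩).subset ⟨i, MulAction.mem_orbit_self i, rfl⟩
    obtain ⟨g, hg⟩ := hmem
    exact ⟨g, g.2, hg⟩
end

section
/- Let G be a subgroup of S_n and let [n] = ⊔_k I_k be a partition of the ground set. Then the permutation polytope P(stab(G;(I_k)_k)) of the partition stabilizer is a face of the permutation polytope P(G). -/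
/-- If a linear functional is nonnegative on `S`, then the part of `S` on which it vanishes spans a
face of the convex hull of `S`. -/
theorem isExtreme_convexHull_of_nonneg {E : Type*} [AddCommGroup E] [Module ℝ E] {S : Set E}
    (f : E →ₗ[ℝ] ℝ) (hf : ∀ x ∈ S, 0 ≤ f x) :
    IsExtreme ℝ (convexHull ℝ S) (convexHull ℝ {x ∈ S | f x = 0}) := by
  set T := {x ∈ S | f x = 0}
  have hpos : ∀ {a b u v : ℝ}, 0 < a → 0 < b → 0 ≤ u → 0 ≤ v → a * u + b * v = 0 →
      u = 0 ∧ v = 0 := by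
    intro a b u v ha hb hu hv h
    have h1 := mul_nonneg ha.le hu
    have h2 := mul_nonneg hb.le hv
    exact ⟨(mul_eq_zero.1 (by linarith)).resolve_left ha.ne',
      (mul_eq_zero.1 (by linarith)).resolve_left hb.ne'⟩
  have hS : convexHull ℝ S ⊆ {x | 0 ≤ f x ∧ (f x = 0 → x ∈ convexHull ℝ T)} := by
    refine convexHull_min (fun x hx => ⟨hf x hx, fun h => subset_convexHull ℝ T ⟨hx, h⟩⟩) ?_
    refine convex_iff_forall_pos.2 fun x hx y hy a b ha hb hab => ⟨?_, fun h => ?_⟩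
    · rw [map_add, map_smul, map_smul, smul_eq_mul, smul_eq_mul]
      exact add_nonneg (mul_nonneg ha.le hx.1) (mul_nonneg hb.le hy.1)
    · rw [map_add, map_smul, map_smul, smul_eq_mul, smul_eq_mul] at h
      obtain ⟨hx0, hy0⟩ := hpos ha hb hx.1 hy.1 h
      exact convex_convexHull ℝ T (hx.2 hx0) (hy.2 hy0) ha.le hb.le hab
  have hT : convexHull ℝ T ⊆ {x | f x = 0} :=
    convexHull_min (fun x hx => hx.2) (convex_hyperplane f.isLinear 0)
  refine ⟨convexHull_mono fun x hx => hx.1, ?_⟩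
  rintro x hx y hy z hz ⟨a, b, ha, hb, -, rfl⟩
  have h := hT hz
  simp only [Set.mem_ofPred_eq, map_add, map_smul, smul_eq_mul] at h
  exact (hS hx).2 (hpos ha hb (hS hx).1 (hS hy).1 h).1

/-- A permutation of a finite type fixes every block of a partition iff it moves every point within
its block. -/
theorem forall_image_eq_iff_of_isPartition {α : Type*} [Finite α] {P : Set (Set α)}
    (hP : Setoid.IsPartition P) (σ : Equiv.Perm α) :
    (∀ I ∈ P, ⇑σ '' I = I) ↔ ∀ j, ∃ I ∈ P, σ j ∈ I ∧ j ∈ I := by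
  constructor
  · intro h j
    obtain ⟨I, ⟨hI, hj⟩, -⟩ := hP.2 j
    exact ⟨I, hI, h I hI ▸ Set.mem_image_of_mem σ hj, hj⟩
  · intro h I hI
    refine Set.eq_of_subset_of_ncard_le ?_ (Set.ncard_image_of_injective I σ.injective).ge
      (Set.toFinite I)
    rintro _ ⟨j, hj, rfl⟩
    obtain ⟨J, hJ, hσj, hjJ⟩ := h j
    rwa [(hP.2 j).unique ⟨hI, hj⟩ ⟨hJ, hjJ⟩]

theorem permMat_nonneg (n : ℕ) (σ : Equiv.Perm (Fin n)) (i j : Fin n) : 0 ≤ permMat n σ i j := by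
  unfold permMat
  split_ifs <;> norm_num

/-- For any subgroup `G ≤ S_n` and any partition of `[n]`, the permutation polytope of the
stabilizer `stab(G; (I_k)_k) = {σ ∈ G : σ(I) = I for all blocks I}` is a face (extreme
subset) of the permutation polytope of `G`. -/
theorem perm_polytope_partition_stabilizer_is_face
    (n : ℕ) (G : Subgroup (Equiv.Perm (Fin n)))
    (Part : Set (Set (Fin n))) (hPart : Setoid.IsPartition Part) :
    IsExtreme ℝ (permPoly n (G : Set (Equiv.Perm (Fin n))))
      (permPoly n {σ : Equiv.Perm (Fin n) | σ ∈ G ∧ ∀ I ∈ Part, ⇑σ '' I = I}) := by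
  classical
  let off : Finset (Fin n × Fin n) := {p | ¬ ∃ I ∈ Part, p.1 ∈ I ∧ p.2 ∈ I}
  let f : Matrix (Fin n) (Fin n) ℝ →ₗ[ℝ] ℝ := ∑ p ∈ off, Matrix.entryLinearMap ℝ ℝ p.1 p.2
  have hf : ∀ M, f M = ∑ p ∈ off, M p.1 p.2 := fun M => by
    simp [f, LinearMap.sum_apply]
  have hzero : ∀ σ, f (permMat n σ) = 0 ↔ ∀ I ∈ Part, ⇑σ '' I = I := by
    intro σ
    rw [hf, Finset.sum_eq_zero_iff_of_nonneg fun p _ => permMat_nonneg n σ p.1 p.2,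
      forall_image_eq_iff_of_isPartition hPart]
    constructor
    · intro h j
      by_contra hj
      have := h (σ j, j) (by simpa [off] using hj)
      simp [permMat] at this
    · rintro h ⟨i, j⟩ hij
      have hne : σ j ≠ i := by
        rintro rfl
        exact (Finset.mem_filter.1 hij).2 (h j)
      simp [permMat, hne]
  have himage : permMat n '' {σ | σ ∈ G ∧ ∀ I ∈ Part, ⇑σ '' I = I} =
      {M ∈ permMat n '' (G : Set (Equiv.Perm (Fin n))) | f M = 0} := by
    ext M
    constructor
    · rintro ⟨σ, ⟨hG, hσ⟩, rfl⟩
      exact ⟨⟨σ, hG, rfl⟩, (hzero σ).2 hσ⟩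
    · rintro ⟨⟨σ, hG, rfl⟩, hσ⟩
      exact ⟨σ, ⟨hG, (hzero σ).1 hσ⟩, rfl⟩
  rw [permPoly, permPoly, himage]
  refine isExtreme_convexHull_of_nonneg f ?_
  rintro _ ⟨σ, -, rfl⟩
  rw [hf]
  exact Finset.sum_nonneg fun p _ => permMat_nonneg n σ p.1 p.2
end

section
/- Let G be a subgroup of S_n and let H ≤ G be a subgroup such that the permutation polytope P(H) is a face of P(G). Let Ĥ := stab(G;(I_k)_k) where [n] = ⊔_k I_k is the partition of [n] into H-orbits. Then P(H) = P(Ĥ). -/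
/-- The orbit of `i ∈ [n]` under a set `S` of permutations. -/
def orbitOf {n : ℕ} (S : Set (Equiv.Perm (Fin n))) (i : Fin n) : Set (Fin n) :=
  {j | ∃ σ ∈ S, σ i = j}

theorem permMat_submatrix {n : ℕ} (σ τ : Equiv.Perm (Fin n)) :
    (permMat n σ).submatrix id τ = permMat n (σ * τ) :=
  rfl

theorem submatrix_mem_permPoly {n : ℕ} {H : Subgroup (Equiv.Perm (Fin n))}
    {τ : Equiv.Perm (Fin n)} (hτ : τ ∈ H) {X : Matrix (Fin n) (Fin n) ℝ}
    (hX : X ∈ permPoly n (H : Set (Equiv.Perm (Fin n)))) :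
    X.submatrix id τ ∈ permPoly n (H : Set (Equiv.Perm (Fin n))) := by
  have hlin : IsLinearMap ℝ
      (fun X : Matrix (Fin n) (Fin n) ℝ => X.submatrix id τ) :=
    ⟨fun _ _ => rfl, fun _ _ => rfl⟩
  have hmin : permPoly n (H : Set (Equiv.Perm (Fin n))) ⊆
      (fun X : Matrix (Fin n) (Fin n) ℝ => X.submatrix id τ) ⁻¹'
        permPoly n (H : Set (Equiv.Perm (Fin n))) := by
    refine convexHull_min ?_ ((convex_convexHull ℝ _).is_linear_preimage hlin)
    rintro _ ⟨σ, hσ, rfl⟩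
    exact subset_convexHull ℝ _ ⟨σ * τ, H.mul_mem hσ hτ, rfl⟩
  exact hmin hX

theorem image_orbitOf_of_mem {n : ℕ} {H : Subgroup (Equiv.Perm (Fin n))}
    {σ : Equiv.Perm (Fin n)} (hσ : σ ∈ H) (k : Fin n) :
    σ '' orbitOf (H : Set (Equiv.Perm (Fin n))) k =
      orbitOf (H : Set (Equiv.Perm (Fin n))) k := by
  ext j
  constructor
  · rintro ⟨_, ⟨τ, hτ, rfl⟩, rfl⟩
    exact ⟨σ * τ, H.mul_mem hσ hτ, rfl⟩
  · rintro ⟨τ, hτ, rfl⟩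
    exact ⟨σ⁻¹ (τ k), ⟨σ⁻¹ * τ, H.mul_mem (H.inv_mem hσ) hτ, rfl⟩, by simp⟩

open Classical in
/-- Left translation by a permutation that preserves every `H`-orbit does not change
the sum of the permutation matrices of `H`. -/
theorem sum_permMat_mul_left {n : ℕ} {H : Subgroup (Equiv.Perm (Fin n))}
    {σ : Equiv.Perm (Fin n)}
    (hσ : ∀ k : Fin n, σ '' orbitOf (H : Set (Equiv.Perm (Fin n))) k =
      orbitOf (H : Set (Equiv.Perm (Fin n))) k) :
    ∑ τ : H, permMat n (σ * τ) = ∑ τ : H, permMat n τ := by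
  ext i j
  have hi : i ∈ σ '' orbitOf (H : Set (Equiv.Perm (Fin n))) i := by
    rw [hσ i]
    exact ⟨1, H.one_mem, rfl⟩
  obtain ⟨_, ⟨g, hg, rfl⟩, hgi⟩ := hi
  rw [Matrix.sum_apply, Matrix.sum_apply,
    ← Equiv.sum_comp (Equiv.mulLeft (⟨g, hg⟩ : H))]
  refine Finset.sum_congr rfl fun τ _ => ?_
  have h : σ (g ((τ : Equiv.Perm (Fin n)) j)) = i ↔ (τ : Equiv.Perm (Fin n)) j = i := by
    conv_lhs => rhs; rw [← hgi]
    rw [σ.injective.eq_iff, g.injective.eq_iff]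
  simp [permMat, h]

open Classical in
theorem permMat_mem_permPoly_of_isExtreme {n : ℕ}
    {G H : Subgroup (Equiv.Perm (Fin n))} (hHG : H ≤ G)
    (hface : IsExtreme ℝ (permPoly n (G : Set (Equiv.Perm (Fin n))))
      (permPoly n (H : Set (Equiv.Perm (Fin n)))))
    {σ : Equiv.Perm (Fin n)} (hσG : σ ∈ G)
    (hσ : ∀ k : Fin n, σ '' orbitOf (H : Set (Equiv.Perm (Fin n))) k =
      orbitOf (H : Set (Equiv.Perm (Fin n))) k) :
    permMat n σ ∈ permPoly n (H : Set (Equiv.Perm (Fin n))) := by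
  by_contra hnot
  have hpos : ∀ τ ∈ (Finset.univ : Finset H), (0 : ℝ) ≤ (Fintype.card H : ℝ)⁻¹ :=
    fun _ _ => by positivity
  have hone : ∑ _τ : H, (Fintype.card H : ℝ)⁻¹ = 1 := by simp
  have hmem : ∑ τ : H, (Fintype.card H : ℝ)⁻¹ • permMat n τ ∈
      permPoly n (H : Set (Equiv.Perm (Fin n))) :=
    (convex_convexHull ℝ _).sum_mem hpos hone fun τ _ =>
      subset_convexHull ℝ _ ⟨τ, τ.2, rfl⟩
  have hdiff : ∑ τ : H, (Fintype.card H : ℝ)⁻¹ • permMat n (σ * τ) ∈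
      permPoly n (G : Set (Equiv.Perm (Fin n))) \
        permPoly n (H : Set (Equiv.Perm (Fin n))) := by
    refine (hface.convex_sdiff (convex_convexHull ℝ _)).sum_mem hpos hone fun τ _ =>
      ⟨subset_convexHull ℝ _ ⟨σ * τ, G.mul_mem hσG (hHG τ.2), rfl⟩, fun h => hnot ?_⟩
    have h' := submatrix_mem_permPoly (H.inv_mem τ.2) h
    rwa [permMat_submatrix, mul_inv_cancel_right] at h'
  rw [← Finset.smul_sum, sum_permMat_mul_left hσ, Finset.smul_sum] at hdiff
  exact hdiff.2 hmem

/-- Let `H ≤ G ≤ S_n` with `P(H)` a face (extreme subset) of `P(G)`, and let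
`Ĥ = stab(G; (I_k)_k)` be the stabilizer in `G` of the partition of `[n]` into
`H`-orbits. Then `P(H) = P(Ĥ)`. -/
theorem perm_polytope_face_eq_poly_of_orbit_stabilizer
    (n : ℕ) (G H : Subgroup (Equiv.Perm (Fin n))) (hHG : H ≤ G)
    (hface : IsExtreme ℝ (permPoly n (G : Set (Equiv.Perm (Fin n))))
      (permPoly n (H : Set (Equiv.Perm (Fin n))))) :
    permPoly n (H : Set (Equiv.Perm (Fin n))) =
      permPoly n {σ : Equiv.Perm (Fin n) | σ ∈ G ∧
        ∀ k : Fin n, ⇑σ '' orbitOf (H : Set (Equiv.Perm (Fin n))) k =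
          orbitOf (H : Set (Equiv.Perm (Fin n))) k} := by
  refine Set.Subset.antisymm (convexHull_mono (Set.image_mono ?_))
    (convexHull_min ?_ (convex_convexHull ℝ _))
  · exact fun σ hσ => ⟨hHG hσ, image_orbitOf_of_mem hσ⟩
  · rintro _ ⟨σ, ⟨hσG, hσ⟩, rfl⟩
    exact permMat_mem_permPoly_of_isExtreme hHG hface hσG hσ
end
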